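/- In the Case 3 setup, give P = B^{⊕n} the right ℂ[ℤ_n]-comodule algebra structure Δ_R(p) = Σ_{i∈ℤ_n} (i▷p) ⊗ δ_i coming from the shift action. Then the linear map ω♯ : ℂ[ℤ_n] → P ⊗ P defined on the basis by ω♯(δ_i) = Σ_{s∈ℤ_n} 1_{,s} ⊗ 1_{,s−i} is a strong universal connection. -/

import Mathlib

open TensorProduct
open scoped Classical

/-! Case 3 setup: `B` a unital ℂ-algebra, `n ≥ 1`, `P = B^{⊕n}` the direct product of
`n` copies of `B`, realised as `ℤ_n → B`.  For `b : B` and `s : ℤ_n`, `b_{,s}` is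
`Pi.single s b`.  `A ⊆ P` is the diagonal subalgebra, and `ℤ_n` acts on `P` by the
shift `(i ▷ p) t = p (t − i)`, so that `i ▷ b_{,s} = b_{,s+i}`. -/

variable (B : Type*) [Ring B] [Algebra ℂ B] (n : ℕ) [NeZero n]

/-- `P = B^{⊕n}`. -/
abbrev PB := ZMod n → B

/-- The diagonal subalgebra `A = {(b,…,b) : b ∈ B}`, as a set. -/
def Aset : Set (PB B n) := Set.range (fun b : B => (fun _ => b : PB B n))

/-- The shift action of `i ∈ ℤ_n` on `P`, `i ▷ b_{,s} = b_{,s+i}`. -/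
noncomputable def shift (i : ZMod n) : PB B n →ₗ[ℂ] PB B n :=
  LinearMap.funLeft ℂ B (fun t => t - i)

/-- The balancing relations over `A` inside `P ⊗[ℂ] P`; the quotient by this submodule
is the balanced tensor product `P ⊗_A P`. -/
noncomputable def relSub : Submodule ℂ (PB B n ⊗[ℂ] PB B n) :=
  Submodule.span ℂ
    {x | ∃ p q a : PB B n, a ∈ Aset B n ∧ x = (p * a) ⊗ₜ[ℂ] q - p ⊗ₜ[ℂ] (a * q)}

/-- The lifted canonical map `Can : P ⊗ P → P ⊗ ℂ[ℤ_n]`,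
`p ⊗ q ↦ Σ_i p·(i▷q) ⊗ δ_i`. -/
noncomputable def Can : (PB B n ⊗[ℂ] PB B n) →ₗ[ℂ] (PB B n ⊗[ℂ] (ZMod n → ℂ)) :=
  ∑ i : ZMod n,
    ((TensorProduct.mk ℂ (PB B n) (ZMod n → ℂ)).flip (Pi.single i 1)) ∘ₗ
      (LinearMap.mul' ℂ (PB B n)) ∘ₗ
        (TensorProduct.map LinearMap.id (shift B n i))

/-- Comultiplication on `ℂ[ℤ_n]`: `Δ(δ_i) = Σ_{j+k=i} δ_j ⊗ δ_k`. -/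
noncomputable def comul : (ZMod n → ℂ) →ₗ[ℂ] ((ZMod n → ℂ) ⊗[ℂ] (ZMod n → ℂ)) :=
  ∑ p : ZMod n × ZMod n,
    (LinearMap.toSpanSingleton ℂ ((ZMod n → ℂ) ⊗[ℂ] (ZMod n → ℂ))
      (Pi.single p.1 (1 : ℂ) ⊗ₜ[ℂ] Pi.single p.2 (1 : ℂ))) ∘ₗ
        LinearMap.proj (p.1 + p.2)

/-- Antipode on `ℂ[ℤ_n]`: `S(δ_i) = δ_{−i}`. -/
noncomputable def antipode : (ZMod n → ℂ) →ₗ[ℂ] (ZMod n → ℂ) :=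
  LinearMap.funLeft ℂ ℂ (fun i => -i)

/-- The right coaction `Δ_R(p) = Σ_i (i▷p) ⊗ δ_i` of `ℂ[ℤ_n]` on `P`. -/
noncomputable def coact : PB B n →ₗ[ℂ] (PB B n ⊗[ℂ] (ZMod n → ℂ)) :=
  ∑ i : ZMod n,
    ((TensorProduct.mk ℂ (PB B n) (ZMod n → ℂ)).flip (Pi.single i 1)) ∘ₗ shift B n i

/-- The lifted canonical map `ver♯(p ⊗ q) = p·q₍₀₎ ⊗ q₍₁₎`. -/
noncomputable def verSharp : (PB B n ⊗[ℂ] PB B n) →ₗ[ℂ] (PB B n ⊗[ℂ] (ZMod n → ℂ)) :=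
  (TensorProduct.map (LinearMap.mul' ℂ (PB B n)) LinearMap.id) ∘ₗ
    (TensorProduct.assoc ℂ (PB B n) (PB B n) (ZMod n → ℂ)).symm.toLinearMap ∘ₗ
      (TensorProduct.map LinearMap.id (coact B n))

/-- The value `ω♯(δ_i) = Σ_{s∈ℤ_n} 1_{,s} ⊗ 1_{,s−i}`. -/
noncomputable def omegaBody (i : ZMod n) : PB B n ⊗[ℂ] PB B n :=
  ∑ s : ZMod n, Pi.single s (1 : B) ⊗ₜ[ℂ] Pi.single (s - i) (1 : B)

/-- The linear map `ω♯ : ℂ[ℤ_n] → P ⊗ P` with `ω♯(δ_i) = Σ_s 1_{,s} ⊗ 1_{,s−i}`. -/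
noncomputable def omegaSharp : (ZMod n → ℂ) →ₗ[ℂ] (PB B n ⊗[ℂ] PB B n) :=
  ∑ i : ZMod n,
    (LinearMap.toSpanSingleton ℂ (PB B n ⊗[ℂ] PB B n) (omegaBody B n i)) ∘ₗ
      LinearMap.proj i

omit [NeZero n] in
lemma shift_single (i s : ZMod n) (b : B) :
    shift B n i (Pi.single s b) = Pi.single (s + i) b := by
  ext t
  simp [shift, LinearMap.funLeft_apply, Pi.single_apply, sub_eq_iff_eq_add]

lemma coact_single (s : ZMod n) (b : B) :
    coact B n (Pi.single s b) =
      ∑ j : ZMod n, Pi.single (s + j) b ⊗ₜ[ℂ] (Pi.single j 1 : ZMod n → ℂ) := by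
  simp [coact, shift_single]

lemma omegaSharp_apply (h : ZMod n → ℂ) :
    omegaSharp B n h = ∑ i : ZMod n, h i • omegaBody B n i := by
  simp [omegaSharp]

lemma omegaSharp_single (i : ZMod n) :
    omegaSharp B n (Pi.single i 1) = omegaBody B n i := by
  simp [omegaSharp_apply, Pi.single_apply]

lemma comul_single (i : ZMod n) :
    comul n (Pi.single i 1) = ∑ j : ZMod n,
      (Pi.single (i - j) 1 : ZMod n → ℂ) ⊗ₜ[ℂ] (Pi.single j 1 : ZMod n → ℂ) := by
  simp only [comul, LinearMap.sum_apply, LinearMap.comp_apply, LinearMap.proj_apply,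
    LinearMap.toSpanSingleton_apply, Pi.single_apply i, ite_smul, one_smul, zero_smul,
    Fintype.sum_prod_type_right, ← eq_sub_iff_add_eq, Finset.sum_ite_eq', Finset.mem_univ, if_true]

omit [NeZero n] in
lemma antipode_single (i : ZMod n) :
    antipode n (Pi.single i 1) = Pi.single (-i) 1 := by
  ext t
  simp [antipode, LinearMap.funLeft_apply, Pi.single_apply, neg_eq_iff_eq_neg]

omit [Algebra ℂ B] in
lemma sum_single_one : ∑ s : ZMod n, (Pi.single s 1 : PB B n) = 1 :=
  Finset.univ_sum_single 1

lemma omegaSharp_one : omegaSharp B n 1 = (1 : PB B n) ⊗ₜ[ℂ] (1 : PB B n) := by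
  simp only [omegaSharp_apply, Pi.one_apply, one_smul, omegaBody]
  rw [Finset.sum_comm, ← sum_single_one B n, TensorProduct.sum_tmul]
  refine Finset.sum_congr rfl fun s _ => ?_
  rw [← TensorProduct.tmul_sum]
  congr 1
  exact (Equiv.subLeft s).sum_comp fun t => (Pi.single t 1 : PB B n)

lemma verSharp_omegaBody (i : ZMod n) :
    verSharp B n (omegaBody B n i) = (1 : PB B n) ⊗ₜ[ℂ] (Pi.single i 1 : ZMod n → ℂ) := by
  rw [← sum_single_one B n, TensorProduct.sum_tmul, omegaBody, map_sum]
  refine Finset.sum_congr rfl fun s _ => ?_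
  simp only [verSharp, LinearMap.comp_apply, TensorProduct.map_tmul, LinearMap.id_apply,
    coact_single, TensorProduct.tmul_sum, map_sum, LinearEquiv.coe_coe,
    TensorProduct.assoc_symm_tmul, LinearMap.mul'_apply]
  rw [Finset.sum_eq_single i]
  · rw [sub_add_cancel, ← Pi.single_mul, one_mul]
  · intro j _ hj
    have hs : s ≠ s - i + j := fun h => hj (by linear_combination -h)
    have hmul : (Pi.single s 1 : PB B n) * Pi.single (s - i + j) 1 = 0 := by
      ext t
      by_cases ht : t = s
      · subst ht; simp [Pi.single_eq_of_ne hs]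
      · simp [Pi.single_eq_of_ne ht]
    rw [hmul, TensorProduct.zero_tmul]
  · simp

lemma verSharp_omegaSharp (h : ZMod n → ℂ) :
    verSharp B n (omegaSharp B n h) = (1 : PB B n) ⊗ₜ[ℂ] h := by
  simp only [omegaSharp_apply, map_sum, map_smul, verSharp_omegaBody, ← TensorProduct.tmul_smul,
    ← TensorProduct.tmul_sum]
  rw [← pi_eq_sum_univ' h]

lemma omegaSharp_right_equivariant :
    (TensorProduct.map LinearMap.id (coact B n)) ∘ₗ omegaSharp B n
      = (TensorProduct.assoc ℂ (PB B n) (PB B n) (ZMod n → ℂ)).toLinearMap ∘ₗ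
          (TensorProduct.map (omegaSharp B n) LinearMap.id) ∘ₗ comul n := by
  refine LinearMap.pi_ext' fun i => LinearMap.ext_ring ?_
  simp only [LinearMap.comp_apply, LinearMap.coe_single, omegaSharp_single, comul_single,
    omegaBody, map_sum, TensorProduct.map_tmul, LinearMap.id_apply, coact_single,
    TensorProduct.tmul_sum, TensorProduct.sum_tmul, LinearEquiv.coe_coe,
    TensorProduct.assoc_tmul]
  rw [Finset.sum_comm]
  simp only [sub_sub_eq_add_sub, sub_add_eq_add_sub]

lemma omegaSharp_left_equivariant :
    (TensorProduct.map (coact B n) LinearMap.id) ∘ₗ omegaSharp B n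
      = (TensorProduct.assoc ℂ (PB B n) (ZMod n → ℂ) (PB B n)).symm.toLinearMap ∘ₗ
          (TensorProduct.leftComm ℂ (ZMod n → ℂ) (PB B n) (PB B n)).toLinearMap ∘ₗ
            (TensorProduct.map (antipode n) (omegaSharp B n)) ∘ₗ comul n := by
  refine LinearMap.pi_ext' fun i => LinearMap.ext_ring ?_
  simp only [LinearMap.comp_apply, LinearMap.coe_single, omegaSharp_single, comul_single,
    omegaBody, map_sum, TensorProduct.map_tmul, LinearMap.id_apply, coact_single,
    antipode_single, TensorProduct.tmul_sum, TensorProduct.sum_tmul, LinearEquiv.coe_coe,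
    TensorProduct.leftComm_tmul, TensorProduct.assoc_symm_tmul, neg_sub]
  rw [Finset.sum_comm, ← (Equiv.subRight i).sum_comp]
  refine Finset.sum_congr rfl fun j _ => ?_
  rw [← (Equiv.subRight (j - i)).sum_comp]
  refine Finset.sum_congr rfl fun s _ => ?_
  simp only [Equiv.subRight_apply, sub_add_cancel]
  rw [show s - (j - i) - i = s - j by ring]

/-- `ω♯` is a strong universal connection for the right
`ℂ[ℤ_n]`-comodule algebra `P = B^{⊕n}`. -/
theorem statement14 :
    omegaSharp B n (1 : ZMod n → ℂ) = (1 : PB B n) ⊗ₜ[ℂ] (1 : PB B n) ∧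
    (∀ h : ZMod n → ℂ,
      verSharp B n (omegaSharp B n h) = (1 : PB B n) ⊗ₜ[ℂ] h) ∧
    (TensorProduct.map LinearMap.id (coact B n)) ∘ₗ omegaSharp B n
      = (TensorProduct.assoc ℂ (PB B n) (PB B n) (ZMod n → ℂ)).toLinearMap ∘ₗ
          (TensorProduct.map (omegaSharp B n) LinearMap.id) ∘ₗ comul n ∧
    (TensorProduct.map (coact B n) LinearMap.id) ∘ₗ omegaSharp B n
      = (TensorProduct.assoc ℂ (PB B n) (ZMod n → ℂ) (PB B n)).symm.toLinearMap ∘ₗ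
          (TensorProduct.leftComm ℂ (ZMod n → ℂ) (PB B n) (PB B n)).toLinearMap ∘ₗ
            (TensorProduct.map (antipode n) (omegaSharp B n)) ∘ₗ comul n := by
  exact ⟨omegaSharp_one B n, verSharp_omegaSharp B n, omegaSharp_right_equivariant B n,
    omegaSharp_left_equivariant B n⟩
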